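/- arXiv:2508.08904 — 6 statements merged into one kernel-verified Lean document; each statement's English description precedes it below -/
import Mathlib

section
/- Let X and Y be topological spaces and let ψ₁ : ℝ∖{0} → X and ψ₂ : Y → X be injective maps such that: (a) Γ₁ := ψ₁(ℝ∖{0}) is open in X and ψ₁ is a homeomorphism of ℝ∖{0} onto Γ₁ (with its subspace topology); (b) Γ₂ := ψ₂(Y) equals X ∖ Γ₁ and ψ₂ is a homeomorphism of Y onto Γ₂; (c) for every subset A ⊆ ℝ∖{0}, the following are equivalent: 0 is an accumulation point of A; Γ₂ ∩ closure(ψ₁(A)) ≠ ∅; Γ₂ ⊆ closure(ψ₁(A)). Then a subset F ⊆ X is closed in X if and only if: (i) ψ₁⁻¹(F) is closed in ℝ∖{0}; (ii) ψ₂⁻¹(F) is closed in Y; and (iii) if 0 is an accumulation point of ψ₁⁻¹(F), then Γ₂ ⊆ F. -/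
/-- **Lemma (description of closed sets).**
Let `X`, `Y` be topological spaces, `ψ₁ : ℝ∖{0} → X`, `ψ₂ : Y → X` injective maps such that
(a) `Γ₁ := ψ₁(ℝ∖{0})` is open and `ψ₁` is a homeomorphism onto `Γ₁`;
(b) `Γ₂ := ψ₂(Y) = X ∖ Γ₁` and `ψ₂` is a homeomorphism onto `Γ₂`;
(c) for every `A ⊆ ℝ∖{0}`: `0` is an accumulation point of `A` iff
    `Γ₂ ∩ closure (ψ₁ '' A) ≠ ∅` iff `Γ₂ ⊆ closure (ψ₁ '' A)`.
Then `F ⊆ X` is closed iff (i) `ψ₁⁻¹ F` is closed, (ii) `ψ₂⁻¹ F` is closed, and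
(iii) if `0` is an accumulation point of `ψ₁⁻¹ F` then `Γ₂ ⊆ F`. -/
theorem stmt0 {X Y : Type*} [TopologicalSpace X] [TopologicalSpace Y]
    (ψ₁ : {x : ℝ // x ≠ 0} → X) (ψ₂ : Y → X)
    (hinj₁ : Function.Injective ψ₁) (hinj₂ : Function.Injective ψ₂)
    (hopen₁ : IsOpen (Set.range ψ₁))
    (hemb₁ : Topology.IsEmbedding ψ₁)
    (hrange₂ : Set.range ψ₂ = (Set.range ψ₁)ᶜ)
    (hemb₂ : Topology.IsEmbedding ψ₂)
    (hc : ∀ A : Set {x : ℝ // x ≠ 0},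
      ((0 : ℝ) ∈ closure (Subtype.val '' A) ↔
        (Set.range ψ₂ ∩ closure (ψ₁ '' A)).Nonempty) ∧
      ((Set.range ψ₂ ∩ closure (ψ₁ '' A)).Nonempty ↔
        Set.range ψ₂ ⊆ closure (ψ₁ '' A)))
    (F : Set X) :
    IsClosed F ↔
      IsClosed (ψ₁ ⁻¹' F) ∧ IsClosed (ψ₂ ⁻¹' F) ∧
        ((0 : ℝ) ∈ closure (Subtype.val '' (ψ₁ ⁻¹' F)) → Set.range ψ₂ ⊆ F) := by
  constructor
  · intro hF
    refine ⟨hF.preimage hemb₁.continuous, hF.preimage hemb₂.continuous, fun h0 => ?_⟩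
    obtain ⟨hacc, hall⟩ := hc (ψ₁ ⁻¹' F)
    exact (hall.1 (hacc.1 h0)).trans (closure_minimal (Set.image_preimage_subset ψ₁ F) hF)
  · rintro ⟨h₁, h₂, h0⟩
    have hclosed₂ : IsClosed (Set.range ψ₂) := hrange₂ ▸ hopen₁.isClosed_compl
    have himage₂ : IsClosed (ψ₂ '' (ψ₂ ⁻¹' F)) :=
      (Topology.IsClosedEmbedding.mk hemb₂ hclosed₂).isClosedMap _ h₂
    have hcover : F ⊆ ψ₁ '' (ψ₁ ⁻¹' F) ∪ ψ₂ '' (ψ₂ ⁻¹' F) := by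
      intro x hx
      by_cases hx₁ : x ∈ Set.range ψ₁
      · obtain ⟨a, rfl⟩ := hx₁
        exact Or.inl ⟨a, hx, rfl⟩
      · obtain ⟨y, rfl⟩ : x ∈ Set.range ψ₂ := hrange₂ ▸ hx₁
        exact Or.inr ⟨y, hx, rfl⟩
    refine isClosed_of_closure_subset fun x hx => ?_
    have hx' := closure_mono hcover hx
    rw [closure_union, himage₂.closure_eq] at hx'
    rcases hx' with hx' | ⟨y, hy, rfl⟩
    · by_cases hx₁ : x ∈ Set.range ψ₁
      · obtain ⟨a, rfl⟩ := hx₁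
        have ha : a ∈ closure (ψ₁ ⁻¹' F) := by
          rw [hemb₁.closure_eq_preimage_closure_image]
          exact hx'
        rwa [h₁.closure_eq] at ha
      · have hx₂ : x ∈ Set.range ψ₂ := hrange₂ ▸ hx₁
        exact h0 ((hc _).1.2 ⟨x, hx₂, hx'⟩) hx₂
    · exact hy
end

section
/- Let X and Y be topological spaces and let ψ₁ : ℝ∖{0} → X and ψ₂ : Y → X be injective maps such that: (a) Γ₁ := ψ₁(ℝ∖{0}) is open in X and ψ₁ is a homeomorphism of ℝ∖{0} onto Γ₁; (b) Γ₂ := ψ₂(Y) equals X ∖ Γ₁ and ψ₂ is a homeomorphism of Y onto Γ₂; (c) for every subset A ⊆ ℝ∖{0}, the following are equivalent: 0 is an accumulation point of A; Γ₂ ∩ closure(ψ₁(A)) ≠ ∅; Γ₂ ⊆ closure(ψ₁(A)). Then X is a T1 topological space if and only if Y is a T1 topological space. -/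
/-- In the setting of the lemma on closed sets (hypotheses (a), (b), (c)),
the topology of `X` is T1 if and only if the topology of `Y` is T1. -/
theorem stmt1 {X Y : Type*} [TopologicalSpace X] [TopologicalSpace Y]
    (ψ₁ : {x : ℝ // x ≠ 0} → X) (ψ₂ : Y → X)
    (hinj₁ : Function.Injective ψ₁) (hinj₂ : Function.Injective ψ₂)
    (hopen₁ : IsOpen (Set.range ψ₁))
    (hemb₁ : Topology.IsEmbedding ψ₁)
    (hrange₂ : Set.range ψ₂ = (Set.range ψ₁)ᶜ)
    (hemb₂ : Topology.IsEmbedding ψ₂)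
    (hc : ∀ A : Set {x : ℝ // x ≠ 0},
      ((0 : ℝ) ∈ closure (Subtype.val '' A) ↔
        (Set.range ψ₂ ∩ closure (ψ₁ '' A)).Nonempty) ∧
      ((Set.range ψ₂ ∩ closure (ψ₁ '' A)).Nonempty ↔
        Set.range ψ₂ ⊆ closure (ψ₁ '' A))) :
    T1Space X ↔ T1Space Y := by
  refine ⟨fun _ => hemb₂.t1Space, fun _ => ⟨fun x => ?_⟩⟩
  by_cases hx : x ∈ Set.range ψ₁
  · obtain ⟨a, rfl⟩ := hx
    refine isClosed_of_closure_subset fun y hy => ?_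
    rw [← Set.image_singleton] at hy
    by_cases hyr : y ∈ Set.range ψ₁
    · obtain ⟨b, rfl⟩ := hyr
      have hb : b ∈ closure {a} := by
        rw [hemb₁.closure_eq_preimage_closure_image]
        exact hy
      rw [closure_singleton, Set.mem_singleton_iff] at hb
      rw [hb, Set.mem_singleton_iff]
    · have h0 := (hc {a}).1.mpr ⟨y, hrange₂ ▸ hyr, hy⟩
      rw [Set.image_singleton, closure_singleton, Set.mem_singleton_iff] at h0
      exact absurd h0.symm a.2
  · have hclosed : IsClosed (Set.range ψ₂) := hrange₂ ▸ hopen₁.isClosed_compl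
    obtain ⟨y, rfl⟩ : x ∈ Set.range ψ₂ := hrange₂ ▸ hx
    rw [← Set.image_singleton]
    exact (Topology.IsClosedEmbedding.mk hemb₂ hclosed).isClosedMap _ isClosed_singleton
end

section
/- Let X = Γ₁ ⊔ Γ₂ be a Heisenberg partition of a topological space X (for some integer n ≥ 1, witnessed by maps ψ₁, ψ₂). Then Γ₂ is a maximal element of ClH(X): Γ₂ is closed in X, and connected and Hausdorff in its subspace topology, and there is no Γ ∈ ClH(X) with Γ₂ strictly contained in Γ. -/
/-- `ClH X` : the closed subsets of `X` that are connected and Hausdorff in the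
subspace topology. -/
def ClH {X : Type*} [TopologicalSpace X] (Γ : Set X) : Prop :=
  IsClosed Γ ∧ IsConnected Γ ∧ T2Space Γ

/-- A set with two distinct points that is Hausdorff in the subspace topology cannot contain a set
`S` accumulating at both points, if any subset of `S` accumulating at the first point also
accumulates at the second one. -/
theorem notMem_closure_of_t2Space {X : Type*} [TopologicalSpace X] {Γ S : Set X} [T2Space Γ]
    {p q : X} (hp : p ∈ Γ) (hq : q ∈ Γ) (hpq : p ≠ q) (hSΓ : S ⊆ Γ)
    (hS : ∀ T ⊆ S, p ∈ closure T → q ∈ closure T) : p ∉ closure S := by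
  intro hpS
  obtain ⟨U, V, hU, hV, hpU, hqV, hUV⟩ :=
    t2_separation (x := (⟨p, hp⟩ : Γ)) (y := ⟨q, hq⟩) (by simpa using hpq)
  obtain ⟨u, hu, rfl⟩ := isOpen_induced_iff.1 hU
  obtain ⟨v, hv, rfl⟩ := isOpen_induced_iff.1 hV
  have hpT : p ∈ closure (u ∩ S) := hu.inter_closure ⟨hpU, hpS⟩
  obtain ⟨x, hxv, hxu, hxS⟩ :=
    mem_closure_iff.1 (hS _ Set.inter_subset_right hpT) v hv hqV
  exact Set.disjoint_left.1 hUV (show (⟨x, hSΓ hxS⟩ : Γ) ∈ Subtype.val ⁻¹' u from hxu) hxv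

/-- In a preconnected set `Γ`, the complement of a nonempty proper closed subset `C`
accumulates at some point of `C`. -/
theorem inter_closure_sdiff_nonempty {X : Type*} [TopologicalSpace X] {Γ C : Set X}
    (hΓc : IsPreconnected Γ) (hC : IsClosed C) (hCne : C.Nonempty)
    (hCΓ : C ⊂ Γ) : (C ∩ closure (Γ \ C)).Nonempty := by
  obtain ⟨x, hxΓ, hxC⟩ := Set.exists_of_ssubset hCΓ
  obtain ⟨c, hc⟩ := hCne
  obtain ⟨y, -, hy⟩ := isPreconnected_closed_iff.1 hΓc C (closure (Γ \ C)) hC isClosed_closure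
    (fun z hz => (em (z ∈ C)).imp id fun h => subset_closure ⟨hz, h⟩)
    ⟨c, hCΓ.1 hc, hc⟩ ⟨x, hxΓ, subset_closure ⟨hxΓ, hxC⟩⟩
  exact ⟨y, hy⟩

/-- If `X = Γ₁ ⊔ Γ₂` is a Heisenberg partition of a topological space `X`
(for some `n ≥ 1`, witnessed by `ψ₁ : ℝ∖{0} → X` and `ψ₂ : ℝ^(2n) → X`), then `Γ₂` is a
maximal element of `ClH(X)`: it is closed, connected and Hausdorff for the subspace
topology, and no element of `ClH(X)` strictly contains it. -/
theorem stmt2 {X : Type*} [TopologicalSpace X] (n : ℕ) (hn : 1 ≤ n)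
    (Γ₁ Γ₂ : Set X)
    (ψ₁ : {x : ℝ // x ≠ 0} → X) (ψ₂ : EuclideanSpace ℝ (Fin (2 * n)) → X)
    (hΓ₁ : Γ₁ = Set.range ψ₁) (hΓ₂ : Γ₂ = Set.range ψ₂)
    (hopen₁ : IsOpen Γ₁)
    (hemb₁ : Topology.IsEmbedding ψ₁)
    (hcompl : Γ₂ = Γ₁ᶜ)
    (hemb₂ : Topology.IsEmbedding ψ₂)
    (hc : ∀ A : Set {x : ℝ // x ≠ 0},
      ((0 : ℝ) ∈ closure (Subtype.val '' A) ↔ (Γ₂ ∩ closure (ψ₁ '' A)).Nonempty) ∧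
      ((Γ₂ ∩ closure (ψ₁ '' A)).Nonempty ↔ Γ₂ ⊆ closure (ψ₁ '' A))) :
    ClH Γ₂ ∧ ∀ Γ : Set X, ClH Γ → ¬ (Γ₂ ⊂ Γ) := by
  have hclosed : IsClosed Γ₂ := hcompl ▸ hopen₁.isClosed_compl
  have hconn : IsConnected Γ₂ := hΓ₂ ▸ isConnected_range hemb₂.continuous
  refine ⟨⟨hclosed, hconn, ?_⟩, ?_⟩
  · subst hΓ₂
    exact hemb₂.toHomeomorph.symm.isEmbedding.t2Space
  rintro Γ ⟨-, hΓconn, hΓT2⟩ hss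
  have himage : ∀ T ⊆ Γ \ Γ₂, ψ₁ '' (ψ₁ ⁻¹' T) = T := fun T hT =>
    Set.image_preimage_eq_of_subset fun x hx => by
      have := (hT hx).2
      rwa [hcompl, Set.mem_compl_iff, not_not, hΓ₁] at this
  have hacc : ∀ T ⊆ Γ \ Γ₂, (Γ₂ ∩ closure T).Nonempty → Γ₂ ⊆ closure T := fun T hT h => by
    have := (hc (ψ₁ ⁻¹' T)).2.1
    rw [himage T hT] at this
    exact this h
  have : Nonempty (Fin (2 * n)) := ⟨⟨0, by omega⟩⟩
  obtain ⟨a, b, hab⟩ := exists_pair_ne (EuclideanSpace ℝ (Fin (2 * n)))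
  have ha : ψ₂ a ∈ Γ₂ := hΓ₂ ▸ Set.mem_range_self a
  have hb : ψ₂ b ∈ Γ₂ := hΓ₂ ▸ Set.mem_range_self b
  refine notMem_closure_of_t2Space (hss.1 ha) (hss.1 hb) (hemb₂.injective.ne hab)
    Set.sdiff_subset (fun T hT h => hacc T hT ⟨_, ha, h⟩ hb) (hacc _ subset_rfl ?_ ha)
  exact inter_closure_sdiff_nonempty hΓconn.isPreconnected hclosed hconn.nonempty hss
end

section
/- Let X = Γ₁ ⊔ Γ₂ be a Heisenberg partition of a topological space X (for some integer n ≥ 1). Then Γ₂ is the unique maximal element of ClH(X): if Γ ∈ ClH(X) is maximal in ClH(X) with respect to inclusion (i.e., no element of ClH(X) strictly contains Γ), then Γ = Γ₂. -/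
/-- A connected nonempty set of reals staying away from `0` is properly contained in a closed
connected set that avoids `0`. -/
theorem exists_isClosed_isConnected_ssuperset {C : Set ℝ} (hC : IsConnected C)
    (h0 : (0 : ℝ) ∉ closure C) :
    ∃ D : Set ℝ, IsClosed D ∧ IsConnected D ∧ (0 : ℝ) ∉ D ∧ C ⊆ D ∧ ∃ y ∈ D, y ∉ C := by
  obtain ⟨ε, hε, hb⟩ : ∃ ε > 0, ∀ y ∈ C, ε ≤ |y| := by
    rw [Metric.mem_closure_iff] at h0
    push Not at h0
    simpa [Real.dist_eq] using h0
  have hsign : ∀ x ∈ C, ∀ y ∈ C, 0 < x → 0 < y := by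
    intro x hx y hy hx0
    by_contra hy0
    have : (0 : ℝ) ∈ C := hC.isPreconnected.ordConnected.out hy hx ⟨not_lt.1 hy0, hx0.le⟩
    exact h0 (subset_closure this)
  have hhalf : ∀ y ∈ C, |y| ≠ ε / 2 := fun y hy h => by linarith [hb y hy]
  obtain ⟨x, hx⟩ := hC.nonempty
  rcases lt_or_ge 0 x with hx0 | hx0
  · refine ⟨Set.Ici (ε / 2), isClosed_Ici, isConnected_Ici, by simpa using hε, fun y hy => ?_,
      ε / 2, Set.self_mem_Ici, fun h => hhalf _ h (abs_of_pos (half_pos hε))⟩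
    have := hb y hy
    rw [abs_of_pos (hsign x hx y hy hx0)] at this
    exact Set.mem_Ici.2 (by linarith)
  · refine ⟨Set.Iic (-(ε / 2)), isClosed_Iic, isConnected_Iic, by simpa using hε, fun y hy => ?_,
      -(ε / 2), Set.self_mem_Iic,
      fun h => hhalf _ h (by rw [abs_neg, abs_of_pos (half_pos hε)])⟩
    have := hb y hy
    rw [abs_of_nonpos (not_lt.1 fun h => hx0.not_gt (hsign y hy x hx h))] at this
    exact Set.mem_Iic.2 (by linarith)

/-- If every subset of `S` adherent to one of the points of `Y` is adherent to all of them, and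
`Y` is adherent to `S`, then a Hausdorff set containing `S` and `Y` forces `Y` to be a
subsingleton. -/
theorem subsingleton_of_closure_dichotomy {X : Type*} [TopologicalSpace X] {Γ S Y : Set X}
    [T2Space Γ] (hS : S ⊆ Γ) (hY : Y ⊆ Γ) (hYS : Y ⊆ closure S)
    (h : ∀ B ⊆ S, (Y ∩ closure B).Nonempty → Y ⊆ closure B) : Y.Subsingleton := by
  intro p hp q hq
  by_contra hpq
  obtain ⟨u, v, hu, hv, hpu, hqv, huv⟩ := t2_separation
    (show (⟨p, hY hp⟩ : Γ) ≠ ⟨q, hY hq⟩ from fun e => hpq (congrArg Subtype.val e))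
  obtain ⟨U, hU, rfl⟩ := isOpen_induced_iff.1 hu
  obtain ⟨V, hV, rfl⟩ := isOpen_induced_iff.1 hv
  have hq' : q ∈ closure (U ∩ S) :=
    h _ Set.inter_subset_right ⟨p, hp, hU.inter_closure ⟨hpu, hYS hp⟩⟩ hq
  obtain ⟨z, hzV, hzU, hzS⟩ := mem_closure_iff.1 hq' V hV hqv
  exact huv.notMem_of_mem_left (a := (⟨z, hS hzS⟩ : Γ)) hzU hzV

/-- If `X = Γ₁ ⊔ Γ₂` is a Heisenberg partition of a topological space `X`
(for some `n ≥ 1`), then `Γ₂` is the unique maximal element of `ClH(X)`: every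
element of `ClH(X)` that is maximal with respect to inclusion equals `Γ₂`. -/
theorem stmt3 {X : Type*} [TopologicalSpace X] (n : ℕ) (hn : 1 ≤ n)
    (Γ₁ Γ₂ : Set X)
    (ψ₁ : {x : ℝ // x ≠ 0} → X) (ψ₂ : EuclideanSpace ℝ (Fin (2 * n)) → X)
    (hΓ₁ : Γ₁ = Set.range ψ₁) (hΓ₂ : Γ₂ = Set.range ψ₂)
    (hopen₁ : IsOpen Γ₁)
    (hemb₁ : Topology.IsEmbedding ψ₁)
    (hcompl : Γ₂ = Γ₁ᶜ)
    (hemb₂ : Topology.IsEmbedding ψ₂)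
    (hc : ∀ A : Set {x : ℝ // x ≠ 0},
      ((0 : ℝ) ∈ closure (Subtype.val '' A) ↔ (Γ₂ ∩ closure (ψ₁ '' A)).Nonempty) ∧
      ((Γ₂ ∩ closure (ψ₁ '' A)).Nonempty ↔ Γ₂ ⊆ closure (ψ₁ '' A)))
    (Γ : Set X) (hΓ : ClH Γ) (hmax : ∀ Γ' : Set X, ClH Γ' → ¬ (Γ ⊂ Γ')) :
    Γ = Γ₂ := by
  have hcl₂ : IsClosed Γ₂ := hcompl ▸ hopen₁.isClosed_compl
  have hClH₂ : ClH Γ₂ := by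
    refine ⟨hcl₂, hΓ₂ ▸ isConnected_range hemb₂.continuous, ?_⟩
    rw [hΓ₂]
    exact hemb₂.toHomeomorph.t2Space
  have hnt : ¬ Γ₂.Subsingleton := by
    have : Nonempty (Fin (2 * n)) := ⟨⟨0, by omega⟩⟩
    obtain ⟨a, b, hab⟩ := exists_pair_ne (EuclideanSpace ℝ (Fin (2 * n)))
    intro h
    exact hab (hemb₂.injective (h (hΓ₂ ▸ Set.mem_range_self a) (hΓ₂ ▸ Set.mem_range_self b)))
  have hclosed_image : ∀ A : Set {x : ℝ // x ≠ 0}, IsClosed A →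
      (0 : ℝ) ∉ closure (Subtype.val '' A) → IsClosed (ψ₁ '' A) := by
    intro A hA h0
    refine isClosed_of_closure_subset fun z hz => ?_
    have hz₂ : z ∉ Γ₂ := fun hz₂ => h0 ((hc A).1.2 ⟨z, hz₂, hz⟩)
    rw [hcompl, Set.notMem_compl_iff, hΓ₁] at hz₂
    obtain ⟨a, rfl⟩ := hz₂
    refine ⟨a, ?_, rfl⟩
    rw [← hA.closure_eq, hemb₁.closure_eq_preimage_closure_image]
    exact hz
  obtain ⟨hcl, hconn, hT2⟩ := hΓ
  set S : Set {x : ℝ // x ≠ 0} := ψ₁ ⁻¹' Γ with hS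
  have hSΓ : ψ₁ '' S ⊆ Γ := Set.image_preimage_subset _ _
  have hScl : IsClosed S := hcl.preimage hemb₁.continuous
  have h0 : (0 : ℝ) ∉ closure (Subtype.val '' S) := by
    intro h
    have hsub : Γ₂ ⊆ closure (ψ₁ '' S) := (hc S).2.1 ((hc S).1.1 h)
    refine hnt (subsingleton_of_closure_dichotomy hSΓ
      (hsub.trans (closure_minimal hSΓ hcl)) hsub fun B hB hne => ?_)
    obtain ⟨A, -, rfl⟩ := Set.subset_image_iff.1 hB
    exact (hc A).2.1 hne
  have hcover : Γ ⊆ ψ₁ '' S ∪ Γ₂ := by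
    intro z hz
    by_cases hz₂ : z ∈ Γ₂
    · exact Or.inr hz₂
    · rw [hcompl, Set.notMem_compl_iff, hΓ₁] at hz₂
      obtain ⟨a, rfl⟩ := hz₂
      exact Or.inl ⟨a, hz, rfl⟩
  have hdisj : ∀ z ∈ ψ₁ '' S, z ∉ Γ₂ := by
    rintro _ ⟨a, -, rfl⟩
    rw [hcompl, hΓ₁]
    exact fun h => h ⟨a, rfl⟩
  rcases isPreconnected_iff_subset_of_disjoint_closed.1 hconn.isPreconnected _ _
    (hclosed_image S hScl h0) hcl₂ hcover
    (Set.eq_empty_of_forall_notMem fun z hz => hdisj z hz.2.1 hz.2.2) with h₁ | h₂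
  · have himg : ψ₁ '' S = Γ := hSΓ.antisymm h₁
    have hSconn : IsConnected S := by
      rw [← himg] at hconn
      exact ⟨hconn.nonempty.of_image, hemb₁.isInducing.isPreconnected_image.1 hconn.isPreconnected⟩
    obtain ⟨D, hDcl, hDconn, h0D, hSD, y, hyD, hyS⟩ := exists_isClosed_isConnected_ssuperset
      (hSconn.image _ continuous_subtype_val.continuousOn) h0
    have hy0 : y ≠ 0 := fun h => h0D (h ▸ hyD)
    have himgD : Subtype.val '' (Subtype.val ⁻¹' D : Set {x : ℝ // x ≠ 0}) = D := by
      refine Set.image_preimage_eq_of_subset fun z hz => ?_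
      exact ⟨⟨z, fun h => h0D (h ▸ hz)⟩, rfl⟩
    set T : Set {x : ℝ // x ≠ 0} := Subtype.val ⁻¹' D
    have hTconn : IsConnected T :=
      ⟨⟨⟨y, hy0⟩, hyD⟩, Topology.IsInducing.subtypeVal.isPreconnected_image.1
        (himgD.symm ▸ hDconn.isPreconnected)⟩
    have hT : ClH (ψ₁ '' T) :=
      ⟨hclosed_image T (hDcl.preimage continuous_subtype_val) (by rwa [himgD, hDcl.closure_eq]),
        hTconn.image _ hemb₁.continuous.continuousOn, (hemb₁.homeomorphImage T).t2Space⟩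
    refine (hmax _ hT ⟨?_, fun h => ?_⟩).elim
    · rw [← himg]
      exact Set.image_mono (Set.image_subset_iff.1 hSD)
    · exact hyS ⟨⟨y, hy0⟩, h ⟨⟨y, hy0⟩, hyD, rfl⟩, rfl⟩
  · by_contra hne
    exact hmax Γ₂ hClH₂ (h₂.ssubset_of_ne hne)
end

section
/- For every topological space X there exists at most one Heisenberg partition: if X = Γ₁ ⊔ Γ₂ is a Heisenberg partition (for some integer n ≥ 1, witnessed by ψ₁ : ℝ∖{0} → X and ψ₂ : ℝ^(2n) → X) and X = Γ₁′ ⊔ Γ₂′ is a Heisenberg partition (for some integer m ≥ 1, witnessed by ψ₁′ : ℝ∖{0} → X and ψ₂′ : ℝ^(2m) → X), then Γ₁ = Γ₁′ and Γ₂ = Γ₂′. -/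
/-- The closed part of a partition as in `stmt4`, if it has at least two points, consists of the
points that cannot be separated by neighbourhoods from some other point. -/
theorem eq_setOf_exists_not_disjoint_nhds {X : Type*} [TopologicalSpace X] {Γ : Set X}
    {ψ : {x : ℝ // x ≠ 0} → X} (hψ : Topology.IsOpenEmbedding ψ) (hΓ : Γ = (Set.range ψ)ᶜ)
    (hnt : Γ.Nontrivial)
    (hc : ∀ A : Set {x : ℝ // x ≠ 0},
      ((0 : ℝ) ∈ closure (Subtype.val '' A) ↔ (Γ ∩ closure (ψ '' A)).Nonempty) ∧
      ((Γ ∩ closure (ψ '' A)).Nonempty ↔ Γ ⊆ closure (ψ '' A))) :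
    Γ = {x | ∃ y, y ≠ x ∧ ¬ Disjoint (nhds x) (nhds y)} := by
  ext x
  constructor
  · intro hx
    obtain ⟨y, hy, hyx⟩ := hnt.exists_ne x
    refine ⟨y, hyx, fun hdisj => ?_⟩
    obtain ⟨U, ⟨hxU, hU⟩, V, ⟨hyV, hV⟩, hUV⟩ :=
      ((nhds_basis_opens x).disjoint_iff (nhds_basis_opens y)).1 hdisj
    have key : ∀ z ∈ Γ, ∀ W : Set X, z ∈ W → IsOpen W →
        (0 : ℝ) ∉ closure (Subtype.val '' (ψ ⁻¹' Wᶜ)) := by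
      intro z hz W hzW hW h0
      have hsub := (hc _).2.1 ((hc _).1.1 h0)
      exact closure_minimal (Set.image_preimage_subset ψ Wᶜ) hW.isClosed_compl (hsub hz) hzW
    have huniv : ψ ⁻¹' Uᶜ ∪ ψ ⁻¹' Vᶜ = Set.univ := by
      rw [← Set.preimage_union, ← Set.compl_inter, hUV.inter_eq, Set.compl_empty,
        Set.preimage_univ]
    have h0 : (0 : ℝ) ∈ closure (Subtype.val '' (ψ ⁻¹' Uᶜ ∪ ψ ⁻¹' Vᶜ)) := by
      rw [huniv, Set.image_univ, Subtype.range_coe_subtype]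
      exact dense_compl_singleton (0 : ℝ) 0
    rw [Set.image_union, closure_union] at h0
    exact h0.elim (key x hx U hxU hU) (key y hy V hyV hV)
  · rintro ⟨y, hyx, hdisj⟩
    rw [hΓ]
    rintro ⟨t, rfl⟩
    apply hdisj
    by_cases hy : y ∈ Γ
    · set A : Set {x : ℝ // x ≠ 0} := {s | |(t : ℝ)| / 2 < |(s : ℝ)|}
      have ht : 0 < |(t : ℝ)| := abs_pos.2 t.2
      have hA : IsOpen A := isOpen_lt (by fun_prop) (by fun_prop)
      have htA : t ∈ A := half_lt_self ht
      have h0 : (0 : ℝ) ∉ closure (Subtype.val '' A) := by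
        intro h
        have hcl : IsClosed {s : ℝ | |(t : ℝ)| / 2 ≤ |s|} :=
          isClosed_le (by fun_prop) (by fun_prop)
        have hsub : Subtype.val '' A ⊆ {s : ℝ | |(t : ℝ)| / 2 ≤ |s|} := by
          rintro _ ⟨s, hs, rfl⟩
          exact le_of_lt (show |(t : ℝ)| / 2 < |(s : ℝ)| from hs)
        have hle := closure_minimal hsub hcl h
        rw [Set.mem_ofPred_eq, abs_zero] at hle
        linarith
      have hyA : y ∉ closure (ψ '' A) := fun h => h0 ((hc A).1.2 ⟨y, hy, h⟩)
      exact Filter.disjoint_of_disjoint_of_mem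
        (Set.disjoint_compl_right_iff_subset.2 subset_closure)
        ((hψ.isOpenMap A hA).mem_nhds ⟨t, htA, rfl⟩) (isClosed_closure.isOpen_compl.mem_nhds hyA)
    · rw [hΓ, Set.mem_compl_iff, not_not] at hy
      obtain ⟨s, rfl⟩ := hy
      rw [← hψ.map_nhds_eq, ← hψ.map_nhds_eq, Filter.disjoint_map hψ.injective,
        disjoint_nhds_nhds]
      exact fun h => hyx (congrArg ψ h.symm)

theorem nontrivial_range_of_injective_euclideanSpace {X : Type*} {n : ℕ} (hn : 1 ≤ n)
    {ψ : EuclideanSpace ℝ (Fin (2 * n)) → X} (hψ : Function.Injective ψ) :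
    (Set.range ψ).Nontrivial := by
  have : Nonempty (Fin (2 * n)) := ⟨⟨0, by omega⟩⟩
  obtain ⟨a, b, hab⟩ := exists_pair_ne (EuclideanSpace ℝ (Fin (2 * n)))
  exact ⟨ψ a, ⟨a, rfl⟩, ψ b, ⟨b, rfl⟩, hψ.ne hab⟩

/-- **Uniqueness of Heisenberg partitions.** If `X = Γ₁ ⊔ Γ₂` is a Heisenberg partition
(for some `n ≥ 1`, witnessed by `ψ₁, ψ₂`) and `X = Γ₁' ⊔ Γ₂'` is a Heisenberg partition
(for some `m ≥ 1`, witnessed by `ψ₁', ψ₂'`), then `Γ₁ = Γ₁'` and `Γ₂ = Γ₂'`. -/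
theorem stmt4 {X : Type*} [TopologicalSpace X]
    (n : ℕ) (hn : 1 ≤ n) (m : ℕ) (hm : 1 ≤ m)
    (Γ₁ Γ₂ Γ₁' Γ₂' : Set X)
    (ψ₁ : {x : ℝ // x ≠ 0} → X) (ψ₂ : EuclideanSpace ℝ (Fin (2 * n)) → X)
    (ψ₁' : {x : ℝ // x ≠ 0} → X) (ψ₂' : EuclideanSpace ℝ (Fin (2 * m)) → X)
    (hΓ₁ : Γ₁ = Set.range ψ₁) (hΓ₂ : Γ₂ = Set.range ψ₂)
    (hopen₁ : IsOpen Γ₁)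
    (hemb₁ : Topology.IsEmbedding ψ₁)
    (hcompl : Γ₂ = Γ₁ᶜ)
    (hemb₂ : Topology.IsEmbedding ψ₂)
    (hc : ∀ A : Set {x : ℝ // x ≠ 0},
      ((0 : ℝ) ∈ closure (Subtype.val '' A) ↔ (Γ₂ ∩ closure (ψ₁ '' A)).Nonempty) ∧
      ((Γ₂ ∩ closure (ψ₁ '' A)).Nonempty ↔ Γ₂ ⊆ closure (ψ₁ '' A)))
    (hΓ₁' : Γ₁' = Set.range ψ₁') (hΓ₂' : Γ₂' = Set.range ψ₂')
    (hopen₁' : IsOpen Γ₁')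
    (hemb₁' : Topology.IsEmbedding ψ₁')
    (hcompl' : Γ₂' = Γ₁'ᶜ)
    (hemb₂' : Topology.IsEmbedding ψ₂')
    (hc' : ∀ A : Set {x : ℝ // x ≠ 0},
      ((0 : ℝ) ∈ closure (Subtype.val '' A) ↔ (Γ₂' ∩ closure (ψ₁' '' A)).Nonempty) ∧
      ((Γ₂' ∩ closure (ψ₁' '' A)).Nonempty ↔ Γ₂' ⊆ closure (ψ₁' '' A))) :
    Γ₁ = Γ₁' ∧ Γ₂ = Γ₂' := by
  have h := eq_setOf_exists_not_disjoint_nhds ⟨hemb₁, hΓ₁ ▸ hopen₁⟩ (hΓ₁ ▸ hcompl)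
    (hΓ₂ ▸ nontrivial_range_of_injective_euclideanSpace hn hemb₂.injective) hc
  have h' := eq_setOf_exists_not_disjoint_nhds ⟨hemb₁', hΓ₁' ▸ hopen₁'⟩ (hΓ₁' ▸ hcompl')
    (hΓ₂' ▸ nontrivial_range_of_injective_euclideanSpace hm hemb₂'.injective) hc'
  have heq : Γ₂ = Γ₂' := h.trans h'.symm
  exact ⟨compl_injective (hcompl.symm.trans (heq.trans hcompl')), heq⟩
end

section
/- Let X = Γ₁ ⊔ Γ₂ be a Heisenberg partition of a topological space X (for some integer n ≥ 1). Then for every continuous injective map γ : 𝕋 → X from the unit circle 𝕋 = {z ∈ ℂ : |z| = 1} into X, the image satisfies γ(𝕋) ⊆ Γ₂. -/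
/-- A continuous real function on the circle which is injective off its zero set is nowhere
positive. -/
theorem Circle.nonpos_of_injective_off_zeros {h : Circle → ℝ} (hcont : Continuous h)
    (hinj : ∀ z w, h z = h w → h z ≠ 0 → z = w) (z : Circle) : h z ≤ 0 := by
  by_contra! hz
  obtain ⟨m, -, hm⟩ := isCompact_univ.exists_isMaxOn Set.univ_nonempty hcont.continuousOn
  have hmax : ∀ w, h w ≤ h m := fun w => hm (Set.mem_univ w)
  have hmpos : 0 < h m := hz.trans_le (hmax z)
  have hpi := Real.pi_pos
  set k : ℝ → ℝ := fun t => h (m * Circle.exp t) with hk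
  have hkcont : Continuous k := hcont.comp (continuous_const.mul Circle.exp.continuous)
  have hk_inj : ∀ s ∈ Set.Ioc (-Real.pi) Real.pi, ∀ t ∈ Set.Ioc (-Real.pi) Real.pi,
      k s = k t → k s ≠ 0 → s = t := by
    intro s hs t ht hst h_ne
    have hexp := mul_left_cancel (hinj _ _ hst h_ne)
    rw [← Circle.arg_exp hs.1 hs.2, ← Circle.arg_exp ht.1 ht.2, hexp]
  have hk0 : k 0 = h m := by simp [hk]
  have hkneg : k (-Real.pi) = k Real.pi := by
    have : Circle.exp (-Real.pi) = Circle.exp Real.pi := by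
      rw [← Circle.exp_add_two_pi]
      congr 1
      ring
    simp [hk, this]
  have hlt : k Real.pi < h m := by
    refine lt_of_le_of_ne (hmax _) fun heq => ?_
    have := hk_inj Real.pi ⟨by linarith, le_rfl⟩ 0 ⟨by linarith, hpi.le⟩ (heq.trans hk0.symm)
      (heq ▸ hmpos.ne')
    linarith
  obtain ⟨c, hc, hcm⟩ := exists_between (max_lt hlt hmpos)
  have hc1 := (le_max_left _ _).trans_lt hc
  have hc0 := (le_max_right _ _).trans_lt hc
  obtain ⟨s, hs, hsc⟩ := intermediate_value_Ioo (by linarith : -Real.pi ≤ 0)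
    hkcont.continuousOn (show c ∈ Set.Ioo (k (-Real.pi)) (k 0) by
      rw [hkneg, hk0]; exact ⟨hc1, hcm⟩)
  obtain ⟨t, ht, htc⟩ := intermediate_value_Ioo' hpi.le
    hkcont.continuousOn (show c ∈ Set.Ioo (k Real.pi) (k 0) by
      rw [hk0]; exact ⟨hc1, hcm⟩)
  have := hk_inj s ⟨hs.1, by linarith [hs.2]⟩ t ⟨by linarith [ht.1], ht.2.le⟩
    (hsc.trans htc.symm) (hsc ▸ hc0.ne')
  linarith [hs.2, ht.1]

/-- A continuous real function on the circle which is injective off its zero set vanishes. -/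
theorem Circle.eq_zero_of_injective_off_zeros {h : Circle → ℝ} (hcont : Continuous h)
    (hinj : ∀ z w, h z = h w → h z ≠ 0 → z = w) (z : Circle) : h z = 0 := by
  refine le_antisymm (nonpos_of_injective_off_zeros hcont hinj z) ?_
  have := nonpos_of_injective_off_zeros hcont.neg
    (fun z w hzw hz => hinj z w (neg_injective hzw) (neg_ne_zero.1 hz)) z
  exact neg_nonpos.1 this

/-- Extending the inverse of an open embedding of `ℝ ∖ {0}` by zero is continuous, provided that
the closure of the image of `A` meets the complement of the range only if `0 ∈ closure A`. -/
theorem Topology.IsOpenEmbedding.continuous_extend_val_zero {X : Type*} [TopologicalSpace X]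
    {ψ : {x : ℝ // x ≠ 0} → X} (hψ : Topology.IsOpenEmbedding ψ)
    (hc : ∀ A : Set {x : ℝ // x ≠ 0}, ((Set.range ψ)ᶜ ∩ closure (ψ '' A)).Nonempty →
      (0 : ℝ) ∈ closure (Subtype.val '' A)) :
    Continuous (Function.extend ψ Subtype.val (fun _ => (0 : ℝ))) := by
  rw [continuous_iff_continuousAt]
  intro p
  by_cases hp : p ∈ Set.range ψ
  · obtain ⟨x, rfl⟩ := hp
    rw [← hψ.continuousAt_iff, Function.extend_comp hψ.injective]
    exact continuous_subtype_val.continuousAt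
  · rw [ContinuousAt, Function.extend_apply' _ _ _ hp, Metric.tendsto_nhds]
    intro ε hε
    have hnot : p ∉ closure (ψ '' {x | ε ≤ |x.1|}) := by
      intro hmem
      obtain ⟨_, ⟨x, hx, rfl⟩, hdist⟩ := Metric.mem_closure_iff.1 (hc _ ⟨p, hp, hmem⟩) ε hε
      rw [dist_comm, Real.dist_0_eq_abs] at hdist
      exact absurd hdist (not_lt.2 hx)
    filter_upwards [isClosed_closure.isOpen_compl.mem_nhds hnot] with q hq
    rw [Real.dist_0_eq_abs]
    by_cases hq' : q ∈ Set.range ψ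
    · obtain ⟨x, rfl⟩ := hq'
      rw [hψ.injective.extend_apply]
      exact not_le.1 fun hx => hq (subset_closure ⟨x, hx, rfl⟩)
    · rwa [Function.extend_apply' _ _ _ hq', abs_zero]

/-- If `X = Γ₁ ⊔ Γ₂` is a Heisenberg partition of a topological space `X`
(for some `n ≥ 1`), then for every continuous injective map `γ : 𝕋 → X` from the unit
circle `𝕋 = {z ∈ ℂ : |z| = 1}` into `X` we have `γ(𝕋) ⊆ Γ₂`. -/
theorem stmt5 {X : Type*} [TopologicalSpace X] (n : ℕ) (hn : 1 ≤ n)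
    (Γ₁ Γ₂ : Set X)
    (ψ₁ : {x : ℝ // x ≠ 0} → X) (ψ₂ : EuclideanSpace ℝ (Fin (2 * n)) → X)
    (hΓ₁ : Γ₁ = Set.range ψ₁) (hΓ₂ : Γ₂ = Set.range ψ₂)
    (hopen₁ : IsOpen Γ₁)
    (hemb₁ : Topology.IsEmbedding ψ₁)
    (hcompl : Γ₂ = Γ₁ᶜ)
    (hemb₂ : Topology.IsEmbedding ψ₂)
    (hc : ∀ A : Set {x : ℝ // x ≠ 0},
      ((0 : ℝ) ∈ closure (Subtype.val '' A) ↔ (Γ₂ ∩ closure (ψ₁ '' A)).Nonempty) ∧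
      ((Γ₂ ∩ closure (ψ₁ '' A)).Nonempty ↔ Γ₂ ⊆ closure (ψ₁ '' A)))
    (γ : Circle → X) (hγcont : Continuous γ) (hγinj : Function.Injective γ) :
    Set.range γ ⊆ Γ₂ := by
  subst hΓ₁
  subst hcompl
  have hψ : Topology.IsOpenEmbedding ψ₁ := ⟨hemb₁, hopen₁⟩
  have hF := hψ.continuous_extend_val_zero fun A hA => (hc A).1.2 hA
  have hzero := Circle.eq_zero_of_injective_off_zeros (hF.comp hγcont) <| by
    intro z w hzw hz
    have hrange : ∀ p, Function.extend ψ₁ Subtype.val (fun _ => (0 : ℝ)) p ≠ 0 →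
        p ∈ Set.range ψ₁ := fun p hp => by
      by_contra hmem
      exact hp (Function.extend_apply' _ _ _ hmem)
    obtain ⟨x, hx⟩ := hrange (γ z) hz
    obtain ⟨y, hy⟩ := hrange (γ w) fun hw => hz (hzw.trans hw)
    simp only [Function.comp_apply, ← hx, ← hy, hψ.injective.extend_apply] at hzw
    exact hγinj (by rw [← hx, ← hy, Subtype.ext hzw])
  rintro _ ⟨z, rfl⟩ ⟨x, hx⟩
  have := hzero z
  rw [Function.comp_apply, ← hx, hψ.injective.extend_apply] at this
  exact x.2 this
end
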